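/- Let n_x ≥ 1, d_z ≥ 0, and d_y ≥ 1 be integers, and let e₁ ∈ ℕ^{n_x} denote the first standard basis exponent vector. Then the cardinality of the set {α ∈ ℕ^{n_x} : |α| ≤ d_z} ∪ {k·d_y·e₁ : k ∈ ℕ, 1 ≤ k ≤ d_z} equals ∑_{j=0}^{d_z} C(n_x+j−1, j) + d_z − ⌊d_z/d_y⌋. In particular, the number of distinct monomials in the manifold-informed library obtained by substituting the sparsest degree-d_y manifold equation y = x₁^{d_y} into a dense degree-d_z library in (x, y) is at least ∑_{j=0}^{d_z} (n_x+j−1)!/(j!(n_x−1)!) + d_z − ⌊d_z/d_y⌋. -/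

import Mathlib

open Finset

theorem aux_card (n j : ℕ) :
    ((Finset.univ : Finset (Fin n)).piAntidiag j).card = Nat.choose (n + j - 1) j := by
  have h := Nat.card_congr (Sym.equivNatSumOfFintype (Fin n) j)
  rw [Nat.card_eq_fintype_card, Sym.card_sym_eq_choose, Fintype.card_fin] at h
  rw [h, ← Nat.card_eq_finsetCard]
  exact Nat.card_congr (Equiv.subtypeEquivRight (by simp))

theorem aux_main (nx dz dy : ℕ) (hnx : 1 ≤ nx) (hdy : 1 ≤ dy) :
    Set.ncard
      ({α : Fin nx → ℕ | ∑ i, α i ≤ dz} ∪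
        {α : Fin nx → ℕ | ∃ k : ℕ, 1 ≤ k ∧ k ≤ dz ∧
          α = Pi.single (⟨0, hnx⟩ : Fin nx) (k * dy)}) =
      (∑ j ∈ Finset.range (dz + 1), Nat.choose (nx + j - 1) j) +
        (dz - dz / dy) := by
  classical
  let A : Finset (Fin nx → ℕ) :=
    (Finset.range (dz + 1)).biUnion fun j => (Finset.univ : Finset (Fin nx)).piAntidiag j
  let f : ℕ → (Fin nx → ℕ) := fun k => Pi.single (⟨0, hnx⟩ : Fin nx) (k * dy)
  let B : Finset (Fin nx → ℕ) := (Finset.Ioc (dz / dy) dz).image f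
  have hA : ∀ α, α ∈ A ↔ ∑ i, α i ≤ dz := by
    intro α
    simp [A, Nat.lt_succ_iff]
  have hf : ∀ k, ∑ i, f k i = k * dy := by
    intro k
    simp [f]
  have hset : ({α : Fin nx → ℕ | ∑ i, α i ≤ dz} ∪
        {α : Fin nx → ℕ | ∃ k : ℕ, 1 ≤ k ∧ k ≤ dz ∧
          α = Pi.single (⟨0, hnx⟩ : Fin nx) (k * dy)}) = ((A ∪ B : Finset _) : Set _) := by
    ext α
    simp only [Set.mem_union, Set.mem_setOf_eq, Finset.mem_coe, Finset.mem_union, hA]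
    constructor
    · rintro (h | ⟨k, h1, h2, rfl⟩)
      · exact Or.inl h
      · by_cases hk : k * dy ≤ dz
        · left
          exact (hf k).trans_le hk
        · right
          refine Finset.mem_image.2 ⟨k, Finset.mem_Ioc.2 ⟨?_, h2⟩, rfl⟩
          rw [Nat.div_lt_iff_lt_mul hdy]
          omega
    · rintro (h | h)
      · exact Or.inl h
      · obtain ⟨k, hk, rfl⟩ := Finset.mem_image.1 h
        rw [Finset.mem_Ioc] at hk
        exact Or.inr ⟨k, Nat.one_le_of_lt hk.1, hk.2, rfl⟩
  rw [hset, Set.ncard_coe_finset, Finset.card_union_of_disjoint]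
  · congr 1
    · rw [Finset.card_biUnion]
      · exact Finset.sum_congr rfl fun j _ => aux_card nx j
      · intro i _ j _ hij
        refine Finset.disjoint_left.2 ?_
        intro α h1 h2
        simp at h1 h2
        exact hij (h1.symm.trans h2)
    · rw [Finset.card_image_of_injective, Nat.card_Ioc]
      intro a b hab
      have h : a * dy = b * dy := by rw [← hf a, ← hf b, hab]
      exact Nat.eq_of_mul_eq_mul_right hdy h
  · rw [Finset.disjoint_left]
    intro α h1 h2
    obtain ⟨k, hk, rfl⟩ := Finset.mem_image.1 h2
    rw [hA, hf] at h1
    rw [Finset.mem_Ioc, Nat.div_lt_iff_lt_mul hdy] at hk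
    omega

/-- **Lower bound on the manifold-informed library size.**
Let `e₁ ∈ ℕ^{nx}` be the first standard basis exponent vector. The set of
monomials obtained by adjoining to all monomials of total degree at most `d_z`
the pure powers `x₁^{k·d_y}` for `k = 1,…,d_z` (arising from substituting the
sparsest manifold equation `y = x₁^{d_y}`) has cardinality
`∑_{j=0}^{d_z} C(nx+j−1, j) + d_z − ⌊d_z/d_y⌋`; in particular the number of
distinct monomials in the manifold-informed library is at least
`∑_{j=0}^{d_z} (nx+j−1)!/(j!(nx−1)!) + d_z − ⌊d_z/d_y⌋`. -/
theorem manifold_informed_library_lower_bound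
    (nx dz dy : ℕ) (hnx : 1 ≤ nx) (hdy : 1 ≤ dy) :
    Set.ncard
      ({α : Fin nx → ℕ | ∑ i, α i ≤ dz} ∪
        {α : Fin nx → ℕ | ∃ k : ℕ, 1 ≤ k ∧ k ≤ dz ∧
          α = Pi.single (⟨0, hnx⟩ : Fin nx) (k * dy)}) =
      (∑ j ∈ Finset.range (dz + 1), Nat.choose (nx + j - 1) j) +
        (dz - dz / dy) ∧
    Set.ncard
      ({α : Fin nx → ℕ | ∑ i, α i ≤ dz} ∪
        {α : Fin nx → ℕ | ∃ k : ℕ, 1 ≤ k ∧ k ≤ dz ∧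
          α = Pi.single (⟨0, hnx⟩ : Fin nx) (k * dy)}) ≥
      (∑ j ∈ Finset.range (dz + 1),
          Nat.factorial (nx + j - 1) / (Nat.factorial j * Nat.factorial (nx - 1))) +
        (dz - dz / dy) := by
  have h := aux_main nx dz dy hnx hdy
  refine ⟨h, ?_⟩
  rw [h]
  apply le_of_eq
  congr 1
  refine Finset.sum_congr rfl fun j _ => ?_
  rw [Nat.choose_eq_factorial_div_factorial (by omega)]
  congr 3
  omega
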